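/- Let ℓ > 0, N ≥ 3, T > 0, and let E_N^ℓ be the discrete heat energy with no-flux conventions. Let x : [0,T] → ℝ^N be an absolutely continuous curve with x(t) ∈ D_ℓ and −ℓ ≤ x_1(t) < ⋯ < x_N(t) ≤ ℓ for all t, satisfying x'(t) ∈ −∂_w E_N^ℓ(x(t)) for almost every t ∈ [0,T]. If x_1(0) = −ℓ and x_N(0) = ℓ, then x_1(t) = −ℓ and x_N(t) = ℓ for all t ∈ [0,T]. -/

import Mathlib

open MeasureTheory Set

/-- The domain `D_ℓ` of the no-flux discretisation on `[-ℓ,ℓ]` (particles indexed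
`1,…,N`): `-2ℓ - x_2 < x_1 < x_2 < ⋯ < x_N < 2ℓ - x_{N-1}`. -/
def noFluxDomain (N : ℕ) (l : ℝ) : Set (ℕ → ℝ) :=
  {x | (∀ i, 1 ≤ i → i < N → x i < x (i + 1)) ∧
       -(2 * l) - x 2 < x 1 ∧ x N < 2 * l - x (N - 1)}

/-- Ball radius with no-flux conventions on `[-ℓ,ℓ]`. -/
noncomputable def noFluxR (N : ℕ) (l : ℝ) (x : ℕ → ℝ) (i : ℕ) : ℝ :=
  if i = 1 then
    (if -l < x 1 then x 2 - x 1 else min (x 2 - x 1) (x 1 + 2 * l + x 2))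
  else if i = N then
    (if x N < l then x N - x (N - 1) else min (x N - x (N - 1)) (2 * l - x (N - 1) - x N))
  else min (x i - x (i - 1)) (x (i + 1) - x i)

/-- The discrete heat energy with no-flux conventions. -/
noncomputable def noFluxEnergy (N : ℕ) (l : ℝ) (x : ℕ → ℝ) : ℝ :=
  -Real.log N - (1 / N : ℝ) * ∑ i ∈ Finset.Icc 1 N, Real.log (noFluxR N l x i)

/-- A primitive starting at `0` whose density is nonpositive wherever the primitive is positive
stays nonpositive. -/
lemma nonpos_of_primitive_of_density_nonpos {T : ℝ} {f w : ℝ → ℝ}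
    (hw : IntervalIntegrable w volume 0 T)
    (hf : ∀ t ∈ Icc (0 : ℝ) T, f t = ∫ s in (0 : ℝ)..t, w s)
    (hneg : ∀ᵐ t ∂(volume.restrict (Icc (0 : ℝ) T)), 0 < f t → w t ≤ 0) :
    ∀ t ∈ Icc (0 : ℝ) T, f t ≤ 0 := by
  intro t ht
  by_contra! hpos
  have hT : 0 ≤ T := ht.1.trans ht.2
  have hcont : ContinuousOn f (Icc 0 T) := by
    have h := intervalIntegral.continuousOn_primitive_interval
      (f := w) (μ := volume) (a := 0) (b := T)
      (by rw [uIcc_of_le hT]; exact (intervalIntegrable_iff_integrableOn_Icc_of_le hT).1 hw)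
    rw [uIcc_of_le hT] at h
    exact h.congr hf
  have hsub : Icc 0 t ⊆ Icc 0 T := Icc_subset_Icc_right ht.2
  let S : Set ℝ := Icc 0 t ∩ f ⁻¹' Iic 0
  have hSc : IsCompact S :=
    isCompact_Icc.of_isClosed_subset
      ((hcont.mono hsub).preimage_isClosed_of_isClosed isClosed_Icc isClosed_Iic)
      inter_subset_left
  have hS0 : S.Nonempty := by
    refine ⟨0, ⟨le_rfl, ht.1⟩, ?_⟩
    have := hf 0 ⟨le_rfl, hT⟩
    simp [this]
  obtain ⟨s, ⟨hst, hfs⟩, hmax⟩ := hSc.exists_isGreatest hS0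
  have hfs' : f s ≤ 0 := hfs
  have hIoc : ∀ u ∈ Ioc s t, 0 < f u := by
    intro u hu
    by_contra! h
    exact absurd (hmax ⟨⟨hst.1.trans hu.1.le, hu.2⟩, h⟩) (not_le.2 hu.1)
  have hws : IntervalIntegrable w volume 0 s :=
    hw.mono_set (by
      rw [uIcc_of_le hst.1, uIcc_of_le hT]; exact Icc_subset_Icc_right (hst.2.trans ht.2))
  have hwt : IntervalIntegrable w volume 0 t :=
    hw.mono_set (by rw [uIcc_of_le ht.1, uIcc_of_le hT]; exact hsub)
  have hdiff : f t - f s = ∫ u in s..t, w u := by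
    rw [hf t ht, hf s (hsub hst), intervalIntegral.integral_interval_sub_left hwt hws]
  have hint : ∫ u in s..t, w u ≤ 0 := by
    rw [intervalIntegral.integral_of_le hst.2]
    refine integral_nonpos_of_ae ?_
    have hsub' : Ioc s t ⊆ Icc 0 T := fun u hu => ⟨hst.1.trans hu.1.le, hu.2.trans ht.2⟩
    filter_upwards [ae_restrict_of_ae_restrict_of_subset hsub' hneg,
      ae_restrict_mem measurableSet_Ioc] with u hu hu'
    exact hu (hIoc u hu')
  linarith

lemma noFluxR_pos {N : ℕ} {l : ℝ} {x : ℕ → ℝ} (hN : 3 ≤ N) (hx : x ∈ noFluxDomain N l)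
    {i : ℕ} (hi : i ∈ Finset.Icc 1 N) : 0 < noFluxR N l x i := by
  obtain ⟨hmono, h1, h2⟩ := hx
  rw [Finset.mem_Icc] at hi
  have h12 := hmono 1 le_rfl (by omega)
  have hNN := hmono (N - 1) (by omega) (by omega)
  rw [show N - 1 + 1 = N by omega] at hNN
  norm_num at h12
  unfold noFluxR
  split_ifs with hi1 _ hiN
  · linarith
  · exact lt_min (by linarith) (by linarith)
  · linarith
  · exact lt_min (by linarith) (by linarith)
  · have ha := hmono (i - 1) (by omega) (by omega)
    have hb := hmono i (by omega) (by omega)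
    rw [show i - 1 + 1 = i by omega] at ha
    exact lt_min (by linarith) (by linarith)

lemma noFluxEnergy_anti {N : ℕ} {l : ℝ} {x y : ℕ → ℝ} (hN : 3 ≤ N) (hx : x ∈ noFluxDomain N l)
    (hxy : ∀ i ∈ Finset.Icc 1 N, noFluxR N l x i ≤ noFluxR N l y i) :
    noFluxEnergy N l y ≤ noFluxEnergy N l x := by
  unfold noFluxEnergy
  have := Finset.sum_le_sum fun i hi => Real.log_le_log (noFluxR_pos hN hx hi) (hxy i hi)
  gcongr

/-- If displacing the single particle `k` to `a` does not shrink any radius, then every velocity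
that is minus a weighted subgradient moves particle `k` towards `a`. -/
lemma velocity_mul_displacement_nonneg {N : ℕ} {l a : ℝ} {x v : ℕ → ℝ} {k : ℕ} (hN : 3 ≤ N)
    (hk : k ∈ Finset.Icc 1 N) (hx : x ∈ noFluxDomain N l)
    (hsubgrad : ∀ y ∈ noFluxDomain N l, noFluxEnergy N l y ≥ noFluxEnergy N l x +
      ∑ i ∈ Finset.Icc 1 N, (-(v i) / N) * (y i - x i))
    (hy : Function.update x k a ∈ noFluxDomain N l)
    (hr : ∀ i ∈ Finset.Icc 1 N, noFluxR N l x i ≤ noFluxR N l (Function.update x k a) i) :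
    0 ≤ v k * (a - x k) := by
  have h := hsubgrad _ hy
  rw [Finset.sum_eq_single_of_mem k hk
    (fun i _ hik => by rw [Function.update_of_ne hik]; ring), Function.update_self] at h
  have hE := noFluxEnergy_anti hN hx hr
  have hNpos : (0 : ℝ) < N := by exact_mod_cast (by omega : 0 < N)
  have h' : 0 ≤ v k * (a - x k) / N := by
    have : -(v k) / N * (a - x k) = -(v k * (a - x k) / N) := by ring
    linarith
  simpa [hNpos.ne'] using mul_nonneg h' hNpos.le

lemma lt_of_mem_noFluxDomain {N : ℕ} {l : ℝ} {x : ℕ → ℝ} (hx : x ∈ noFluxDomain N l) {i j : ℕ}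
    (hi : 1 ≤ i) (hij : i < j) (hj : j ≤ N) : x i < x j := by
  induction j, hij using Nat.le_induction with
  | base => exact hx.1 i hi (by omega)
  | succ m hm ih => exact (ih (by omega)).trans (hx.1 m (by omega) (by omega))

lemma first_velocity_nonpos {N : ℕ} {l : ℝ} {x v : ℕ → ℝ} (hN : 3 ≤ N)
    (hx : x ∈ noFluxDomain N l) (hx1 : -l < x 1)
    (hsubgrad : ∀ y ∈ noFluxDomain N l, noFluxEnergy N l y ≥ noFluxEnergy N l x +
      ∑ i ∈ Finset.Icc 1 N, (-(v i) / N) * (y i - x i)) :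
    v 1 ≤ 0 := by
  have h12 : x 1 < x 2 := lt_of_mem_noFluxDomain hx le_rfl (by omega) (by omega)
  have hne : ∀ i, i ≠ 1 → Function.update x 1 (-l) i = x i :=
    fun i hi => Function.update_of_ne hi _ _
  have hself : Function.update x 1 (-l) 1 = -l := Function.update_self ..
  have h := velocity_mul_displacement_nonneg (k := 1) (a := -l) hN
    (Finset.mem_Icc.2 ⟨le_rfl, by omega⟩) hx hsubgrad ?_ ?_
  · by_contra! hv
    nlinarith
  · refine ⟨fun i hi hiN => ?_, ?_, ?_⟩
    · rw [hne (i + 1) (by omega)]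
      obtain rfl | hi1 := eq_or_ne i 1
      · rw [hself]; exact hx1.trans h12
      · rw [hne i hi1]; exact hx.1 i hi hiN
    · rw [hself, hne 2 (by omega)]; linarith
    · rw [hne N (by omega), hne (N - 1) (by omega)]; exact hx.2.2
  · intro i hi
    rw [Finset.mem_Icc] at hi
    unfold noFluxR
    obtain rfl | hi1 := eq_or_ne i 1
    · simp only [if_true, hself, hne 2 (by omega), hx1, lt_irrefl, if_false]
      exact le_min (by linarith) (by linarith)
    · rw [if_neg hi1, if_neg hi1, hne N (by omega), hne (N - 1) (by omega), hne i hi1,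
        hne (i + 1) (by omega)]
      split_ifs
      · rfl
      · rfl
      · obtain rfl | hi2 := eq_or_ne i 2
        · norm_num only
          rw [hself]
          exact min_le_min_right _ (by linarith)
        · rw [hne (i - 1) (by omega)]

lemma last_velocity_nonneg {N : ℕ} {l : ℝ} {x v : ℕ → ℝ} (hN : 3 ≤ N)
    (hx : x ∈ noFluxDomain N l) (hxN : x N < l)
    (hsubgrad : ∀ y ∈ noFluxDomain N l, noFluxEnergy N l y ≥ noFluxEnergy N l x +
      ∑ i ∈ Finset.Icc 1 N, (-(v i) / N) * (y i - x i)) :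
    0 ≤ v N := by
  have hNN : x (N - 1) < x N := lt_of_mem_noFluxDomain hx (by omega) (by omega) le_rfl
  have hne : ∀ i, i ≠ N → Function.update x N l i = x i :=
    fun i hi => Function.update_of_ne hi _ _
  have hself : Function.update x N l N = l := Function.update_self ..
  have h := velocity_mul_displacement_nonneg (k := N) (a := l) hN
    (Finset.mem_Icc.2 ⟨by omega, le_rfl⟩) hx hsubgrad ?_ ?_
  · by_contra! hv
    nlinarith
  · refine ⟨fun i hi hiN => ?_, ?_, ?_⟩
    · rw [hne i (by omega)]
      obtain hi1 | hi1 := eq_or_ne (i + 1) N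
      · rw [hi1, hself, show i = N - 1 by omega]; exact hNN.trans hxN
      · rw [hne (i + 1) hi1]; exact hx.1 i hi hiN
    · rw [hne 1 (by omega), hne 2 (by omega)]; exact hx.2.1
    · rw [hself, hne (N - 1) (by omega)]; linarith
  · intro i hi
    rw [Finset.mem_Icc] at hi
    unfold noFluxR
    rw [hne 1 (by omega), hne 2 (by omega), hself, hne (N - 1) (by omega)]
    obtain rfl | hiN := eq_or_ne i N
    · have hi1 : i ≠ 1 := by omega
      simp only [hi1, hxN, lt_irrefl, if_true, if_false]
      exact le_min (by linarith) (by linarith)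
    · rw [if_neg hiN, if_neg hiN, hne i hiN, hne (i - 1) (by omega)]
      split_ifs
      · rfl
      · rfl
      · obtain hi1 | hi1 := eq_or_ne (i + 1) N
        · rw [hi1, hself]
          exact min_le_min_left _ (by linarith)
        · rw [hne (i + 1) hi1]

/-- Along a discrete gradient flow for the no-flux heat energy
(`x` absolutely continuous with a.e. derivative `v` and `x'(t) ∈ -∂_w E_N^ℓ(x(t))`
a.e., i.e. `-(x'(t))/N` is a subgradient at `x(t)`), boundary particles stay at the
boundary: if `x_1(0) = -ℓ` and `x_N(0) = ℓ`, then `x_1(t) = -ℓ` and `x_N(t) = ℓ`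
for all `t ∈ [0,T]`. -/
theorem noflux_boundary_particles_fixed (l : ℝ) (hl : 0 < l) (N : ℕ) (hN : 3 ≤ N)
    (T : ℝ) (hT : 0 < T) (x v : ℝ → ℕ → ℝ)
    (hdom : ∀ t ∈ Icc (0 : ℝ) T, x t ∈ noFluxDomain N l)
    (hbox : ∀ t ∈ Icc (0 : ℝ) T, -l ≤ x t 1 ∧ x t N ≤ l)
    (hvint : ∀ i, IntervalIntegrable (fun s => v s i) volume 0 T)
    (hftc : ∀ t ∈ Icc (0 : ℝ) T, ∀ i, x t i = x 0 i + ∫ s in (0 : ℝ)..t, v s i)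
    (hincl : ∀ᵐ t ∂(volume.restrict (Icc (0 : ℝ) T)),
      ∀ y ∈ noFluxDomain N l,
        noFluxEnergy N l y ≥ noFluxEnergy N l (x t) +
          ∑ i ∈ Finset.Icc 1 N, (-(v t i) / N) * (y i - x t i))
    (h10 : x 0 1 = -l) (hN0 : x 0 N = l) :
    ∀ t ∈ Icc (0 : ℝ) T, x t 1 = -l ∧ x t N = l := by
  have hmem := ae_restrict_mem (μ := volume) (measurableSet_Icc (a := (0 : ℝ)) (b := T))
  have hfirst : ∀ t ∈ Icc (0 : ℝ) T, x t 1 + l ≤ 0 := by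
    refine nonpos_of_primitive_of_density_nonpos (hvint 1) (fun t ht => ?_) ?_
    · rw [hftc t ht 1, h10]; ring
    · filter_upwards [hincl, hmem] with t ht htT hpos
      exact first_velocity_nonpos hN (hdom t htT) (by linarith) ht
  have hlast : ∀ t ∈ Icc (0 : ℝ) T, l - x t N ≤ 0 := by
    refine nonpos_of_primitive_of_density_nonpos (hvint N).neg (fun t ht => ?_) ?_
    · simp only [Pi.neg_apply]
      rw [hftc t ht N, hN0, intervalIntegral.integral_neg]; ring
    · filter_upwards [hincl, hmem] with t ht htT hpos
      exact neg_nonpos.2 (last_velocity_nonneg hN (hdom t htT) (by linarith) ht)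
  intro t ht
  have := hbox t ht
  exact ⟨by linarith [hfirst t ht], by linarith [hlast t ht]⟩
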